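/- Let V(ν₁,ν₂,r) be the 4×4 squeezed-thermal covariance matrix in standard form with symplectic eigenvalues ν₁, ν₂ ≥ 1/2 and squeezing strength r > 0, and let D(V) = (1/2)·I₄ − V be the dissipator corresponding to local damping of both modes (linear Lindblad operators L₁ = a₁, L₂ = a₂, i.e., B = J/2 and A = I₄/2). Then there exists a real symmetric 4×4 matrix G with JGV − VGJ + D(V) = 0 if and only if ν₁ = ν₂ = cosh(2r)/2. -/

import Mathlib

open Matrix

noncomputable def J4 : Matrix (Fin 4) (Fin 4) ℝ :=
  !![0, 1, 0, 0; -1, 0, 0, 0; 0, 0, 0, 1; 0, 0, -1, 0]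

noncomputable def Vsf (ν₁ ν₂ r : ℝ) : Matrix (Fin 4) (Fin 4) ℝ :=
  !![ν₁ * Real.cosh r ^ 2 + ν₂ * Real.sinh r ^ 2, 0,
       (ν₁ + ν₂) / 2 * Real.sinh (2*r), 0;
     0, ν₁ * Real.cosh r ^ 2 + ν₂ * Real.sinh r ^ 2, 0,
       -((ν₁ + ν₂) / 2 * Real.sinh (2*r));
     (ν₁ + ν₂) / 2 * Real.sinh (2*r), 0,
       ν₁ * Real.sinh r ^ 2 + ν₂ * Real.cosh r ^ 2, 0;
     0, -((ν₁ + ν₂) / 2 * Real.sinh (2*r)), 0,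
       ν₁ * Real.sinh r ^ 2 + ν₂ * Real.cosh r ^ 2]

/-- Pairing the steady-state equation for local damping with `J₄ᵀ V J₄` and with the adjugate of
`V` eliminates the Hamiltonian matrix `G`. -/
lemma trace_conditions_of_local_damping {a b c : ℝ} {G : Matrix (Fin 4) (Fin 4) ℝ} (hG : Gᵀ = G)
    (h : J4 * G * !![a, 0, c, 0; 0, a, 0, -c; c, 0, b, 0; 0, -c, 0, b]
        - !![a, 0, c, 0; 0, a, 0, -c; c, 0, b, 0; 0, -c, 0, b] * G * J4
        + ((1/2 : ℝ) • (1 : Matrix (Fin 4) (Fin 4) ℝ)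
          - !![a, 0, c, 0; 0, a, 0, -c; c, 0, b, 0; 0, -c, 0, b]) = 0) :
    (a + b) / 2 - a ^ 2 - b ^ 2 + 2 * c ^ 2 = 0 ∧ (a + b) / 2 - 2 * (a * b) + 2 * c ^ 2 = 0 := by
  have sym (i j : Fin 4) : G i j = G j i := congrFun (congrFun hG j) i
  have e00 := congrFun (congrFun h 0) 0
  have e11 := congrFun (congrFun h 1) 1
  have e22 := congrFun (congrFun h 2) 2
  have e33 := congrFun (congrFun h 3) 3
  have e02 := congrFun (congrFun h 0) 2
  have e13 := congrFun (congrFun h 1) 3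
  simp only [Matrix.add_apply, Matrix.sub_apply, Matrix.zero_apply, Matrix.mul_apply,
    Fin.sum_univ_four] at e00 e11 e22 e33 e02 e13
  simp [J4, sym 1 0, sym 2 0, sym 3 0, sym 2 1, sym 3 1,
    sym 3 2] at e00 e11 e22 e33 e02 e13
  constructor
  · linear_combination a / 2 * (e00 + e11) + b / 2 * (e22 + e33) - c * e02 + c * e13
  · linear_combination b / 2 * (e00 + e11) + a / 2 * (e22 + e33) - c * e02 + c * e13

theorem stmt_15 (ν₁ ν₂ r : ℝ) (h1 : 1/2 ≤ ν₁) (h2 : 1/2 ≤ ν₂) (hr : 0 < r) :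
    (∃ G : Matrix (Fin 4) (Fin 4) ℝ, Gᵀ = G ∧
        J4 * G * Vsf ν₁ ν₂ r - Vsf ν₁ ν₂ r * G * J4
          + ((1/2 : ℝ) • (1 : Matrix (Fin 4) (Fin 4) ℝ) - Vsf ν₁ ν₂ r) = 0) ↔
    (ν₁ = Real.cosh (2*r) / 2 ∧ ν₂ = Real.cosh (2*r) / 2) := by
  have hch := Real.cosh_pos (2 * r)
  have hsq := Real.cosh_sq (2 * r)
  have hcs := Real.cosh_sq r
  have h2r := Real.cosh_two_mul r
  constructor
  · rintro ⟨G, hG, h⟩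
    obtain ⟨hadj, hinv⟩ := trace_conditions_of_local_damping hG h
    have hν : ν₁ = ν₂ := by
      have hd : (ν₁ - ν₂) ^ 2 = 0 := by
        have hab : ((ν₁ * Real.cosh r ^ 2 + ν₂ * Real.sinh r ^ 2)
            - (ν₁ * Real.sinh r ^ 2 + ν₂ * Real.cosh r ^ 2)) ^ 2 = 0 := by
          linear_combination hinv - hadj
        rw [hcs] at hab
        linear_combination hab
      exact sub_eq_zero.mp (pow_eq_zero_iff two_ne_zero |>.mp hd)
    subst hν
    have ha : ν₁ * Real.cosh r ^ 2 + ν₁ * Real.sinh r ^ 2 = ν₁ * Real.cosh (2 * r) := by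
      rw [h2r]; ring
    rw [add_comm (ν₁ * Real.sinh r ^ 2), ha] at hinv
    have hprod : ν₁ * (Real.cosh (2 * r) - 2 * ν₁) = 0 := by
      linear_combination hinv + 2 * ν₁ ^ 2 * hsq
    have hne : ν₁ ≠ 0 := by linarith
    have := (mul_eq_zero.mp hprod).resolve_left hne
    constructor <;> linarith
  · rintro ⟨rfl, rfl⟩
    have ha : Real.cosh (2 * r) / 2 * Real.cosh r ^ 2 + Real.cosh (2 * r) / 2 * Real.sinh r ^ 2
        = Real.cosh (2 * r) ^ 2 / 2 := by
      linear_combination -Real.cosh (2 * r) / 2 * h2r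
    have hb : Real.cosh (2 * r) / 2 * Real.sinh r ^ 2 + Real.cosh (2 * r) / 2 * Real.cosh r ^ 2
        = Real.cosh (2 * r) ^ 2 / 2 := by
      rw [add_comm, ha]
    obtain ⟨k, hk⟩ : ∃ k, k * Real.cosh (2 * r) = Real.sinh (2 * r) / 2 :=
      ⟨Real.sinh (2 * r) / 2 / Real.cosh (2 * r), div_mul_cancel₀ _ hch.ne'⟩
    refine ⟨!![0, 0, 0, k; 0, 0, k, 0; 0, k, 0, 0; k, 0, 0, 0], ?_, ?_⟩
    · ext i j
      fin_cases i <;> fin_cases j <;> rfl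
    · rw [Vsf, ha, hb]
      ext i j
      fin_cases i <;> fin_cases j <;>
        simp [J4] <;>
        first
        | linear_combination Real.sinh (2 * r) * hk - hsq / 2
        | linear_combination Real.cosh (2 * r) * hk
        | linear_combination -Real.cosh (2 * r) * hk
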